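/- arXiv:2311.05727 — 10 statements merged into one kernel-verified Lean document; each statement's English description precedes it below -/
import Mathlib

section
/- Let m ≥ 1, ε > 0, and let r : ℝ × ℝ^m → ℝ be continuously differentiable and satisfy the eikonal condition ‖∇_y r(x,y)‖ = 1 at every point (x,y) with |r(x,y)| < ε. Let Υ : ℝ → ℝ^m be differentiable with Υ'(x) = −(∂_x r(x,Υ(x))) · ∇_y r(x,Υ(x)) for every x ∈ ℝ, and suppose r(x₀, Υ(x₀)) = 0 for some x₀ ∈ ℝ. Then r(x, Υ(x)) = 0 for every x ∈ ℝ; i.e., the trajectory of the ODE driven by the field −(∂_x r) ∇_y r remains on the zero level set of r. -/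
open scoped RealInnerProductSpace

/-- trajectory-invariance part of Proposition 2.1.
If `r : ℝ × ℝ^m → ℝ` is `C¹` and satisfies the eikonal condition `‖∇_y r(x,y)‖ = 1`
wherever `|r(x,y)| < ε`, and `Υ` solves the ODE `Υ'(x) = -(∂ₓ r(x,Υ(x))) • ∇_y r(x,Υ(x))`
with `r(x₀, Υ(x₀)) = 0`, then `r(x, Υ(x)) = 0` for all `x`. -/
theorem stmt_0 (m : ℕ) (hm : 1 ≤ m) (ε : ℝ) (hε : 0 < ε)
    (r : ℝ → EuclideanSpace ℝ (Fin m) → ℝ)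
    (hr : ContDiff ℝ 1 (fun p : ℝ × EuclideanSpace ℝ (Fin m) => r p.1 p.2))
    (heik : ∀ (x : ℝ) (y : EuclideanSpace ℝ (Fin m)),
      |r x y| < ε → ‖gradient (r x) y‖ = 1)
    (U : ℝ → EuclideanSpace ℝ (Fin m))
    (hU : ∀ x : ℝ, HasDerivAt U
      (-(deriv (fun x' => r x' (U x)) x) • gradient (r x) (U x)) x)
    (x₀ : ℝ) (h₀ : r x₀ (U x₀) = 0) :
    ∀ x : ℝ, r x (U x) = 0 := by
  have key : ∀ x, ∃ g', HasDerivAt (fun x => r x (U x)) g' x ∧ (|r x (U x)| < ε → g' = 0) := by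
    intro x
    have hd : DifferentiableAt ℝ (fun p : ℝ × EuclideanSpace ℝ (Fin m) => r p.1 p.2) (x, U x) :=
      (hr.differentiable one_ne_zero) _
    obtain ⟨L, hL⟩ := hd
    have h1 : HasDerivAt (fun x' => r x' (U x)) (L (1, 0)) x :=
      HasFDerivAt.comp_hasDerivAt (f := fun t : ℝ => (t, U x)) x hL
        ((hasDerivAt_id x).prodMk (hasDerivAt_const x (U x)))
    have h2 : HasFDerivAt (r x) (L.comp (ContinuousLinearMap.inr ℝ ℝ _)) (U x) :=
      HasFDerivAt.comp (f := fun y => (x, y)) (U x) hL (hasFDerivAt_prodMk_right x (U x))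
    have hgrad : ∀ v, L (0, v) = ⟪gradient (r x) (U x), v⟫ := by
      intro v
      rw [gradient, InnerProductSpace.toDual_symm_apply, h2.fderiv]
      rfl
    have h3 := HasFDerivAt.comp_hasDerivAt (f := fun t : ℝ => (t, U t)) x hL
        ((hasDerivAt_id x).prodMk (hU x))
    refine ⟨_, h3, fun hx => ?_⟩
    rw [h1.deriv]
    have hsplit : ∀ v : EuclideanSpace ℝ (Fin m), L (1, v) = L (1, 0) + L (0, v) := by
      intro v
      rw [← map_add]
      simp
    rw [hsplit, hgrad, real_inner_smul_right, real_inner_self_eq_norm_sq, heik x (U x) hx]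
    ring
  have hc : Continuous (fun x => r x (U x)) :=
    continuous_iff_continuousAt.2 fun x => (key x).choose_spec.1.continuousAt
  have hclopen : IsClopen {x | r x (U x) = 0} := by
    refine ⟨isClosed_eq hc continuous_const, ?_⟩
    rw [Metric.isOpen_iff]
    intro a ha
    have ha' : r a (U a) = 0 := ha
    have hop : IsOpen {x | |r x (U x)| < ε} := isOpen_lt hc.abs continuous_const
    obtain ⟨δ, hδ, hb⟩ := Metric.isOpen_iff.1 hop a (by simpa [ha'] using hε)
    refine ⟨δ, hδ, fun y hy => ?_⟩
    have hz : ∀ z ∈ Metric.ball a δ, HasDerivAt (fun x => r x (U x)) 0 z := by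
      intro z hz
      obtain ⟨g', hg, h0⟩ := key z
      rw [h0 (hb hz)] at hg
      exact hg
    have := (convex_ball a δ).norm_image_sub_le_of_norm_hasDerivWithin_le (C := 0)
      (fun z h => (hz z h).hasDerivWithinAt) (by simp) (Metric.mem_ball_self hδ) hy
    simpa [ha'] using this
  intro x
  have := hclopen.eq_univ ⟨x₀, h₀⟩
  have hx : x ∈ {x | r x (U x) = 0} := this ▸ Set.mem_univ x
  exact hx
end

section
/- Let m ≥ 1, ε > 0, and let r : ℝ × ℝ^m → ℝ be continuously differentiable, such that the vector field F(x,y) := −(∂_x r(x,y)) ∇_y r(x,y) is bounded and Lipschitz continuous in y uniformly in x (so that through every initial point there is a unique global solution of the ODE Υ' = F(x,Υ)), and such that the eikonal condition ‖∇_y r(x,y)‖ = 1 holds at every point (x,y) with |r(x,y)| < ε. Then for all x₀, x ∈ ℝ the zero level sets are carried onto each other by the flow: {y ∈ ℝ^m : r(x,y) = 0} = {Υ(x) : Υ : ℝ → ℝ^m differentiable, Υ'(s) = F(s,Υ(s)) for all s ∈ ℝ, and r(x₀, Υ(x₀)) = 0}. -/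
open scoped RealInnerProductSpace

theorem aux_global {E : Type*} [NormedAddCommGroup E] [NormedSpace ℝ E] [CompleteSpace E]
    (F : ℝ → E → E) (C : ℝ) (hbd : ∀ x y, ‖F x y‖ ≤ C)
    (L : NNReal) (hLip : ∀ x : ℝ, LipschitzWith L (F x))
    (hcont : ∀ y, Continuous (fun x => F x y)) (x : ℝ) (y : E) :
    ∃ U : ℝ → E, (∀ s : ℝ, HasDerivAt U (F s (U s)) s) ∧ U x = y := by
  have hloc : ∀ n : ℕ, ∃ α : ℝ → E, α x = y ∧
      ∀ t ∈ Set.Ioo (x - (n + 1)) (x + (n + 1)), HasDerivAt α (F t (α t)) t := by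
    intro n
    have hn : (0 : ℝ) < n + 1 := by positivity
    have hC : 0 ≤ C := (norm_nonneg _).trans (hbd x y)
    have hpl : IsPicardLindelof F (tmin := x - (n + 1)) (tmax := x + (n + 1))
        ⟨x, by constructor <;> linarith⟩ y (C.toNNReal * (n + 1)) 0 C.toNNReal L := by
      refine ⟨fun t _ => (hLip t).lipschitzOnWith, fun z _ => (hcont z).continuousOn,
        fun t _ z _ => ?_, ?_⟩
      · rw [Real.coe_toNNReal _ hC]; exact hbd t z
      · simp
    obtain ⟨α, h0, h1⟩ := hpl.exists_eq_forall_mem_Icc_hasDerivWithinAt₀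
    exact ⟨α, h0, fun t ht =>
      (h1 t (Set.Ioo_subset_Icc_self ht)).hasDerivAt (Icc_mem_nhds ht.1 ht.2)⟩
  choose α h0 h1 using hloc
  have huniq' : ∀ k n : ℕ, k ≤ n → ∀ s ∈ Set.Ioo (x - (k + 1)) (x + (k + 1)), α k s = α n s := by
    intro k n hkn s hs
    have hkn' : (k : ℝ) ≤ n := by exact_mod_cast hkn
    have hk : (0 : ℝ) < k + 1 := by positivity
    refine ODE_solution_unique_of_mem_Ioo (v := F) (K := L) (s := fun _ => Set.univ)
      (a := x - (k + 1)) (b := x + (k + 1)) (t₀ := x)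
      (fun t _ => (hLip t).lipschitzOnWith) ⟨by linarith, by linarith⟩
      (fun t ht => ⟨h1 k t ht, trivial⟩)
      (fun t ht => ⟨h1 n t ⟨by linarith [ht.1], by linarith [ht.2]⟩, trivial⟩) ?_ hs
    rw [h0, h0]
  have huniq : ∀ k n : ℕ, ∀ s ∈ Set.Ioo (x - (k + 1)) (x + (k + 1)),
      s ∈ Set.Ioo (x - (n + 1)) (x + (n + 1)) → α k s = α n s := by
    intro k n s hk hn
    rcases le_total k n with h | h
    · exact huniq' k n h s hk
    · exact (huniq' n k h s hn).symm
  have hmem : ∀ s : ℝ, s ∈ Set.Ioo (x - ((⌈|s - x|⌉₊ : ℝ) + 1)) (x + ((⌈|s - x|⌉₊ : ℝ) + 1)) := by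
    intro s
    have h := Nat.le_ceil |s - x|
    have h2 := abs_le.mp h
    constructor <;> linarith [h2.1, h2.2]
  refine ⟨fun s => α ⌈|s - x|⌉₊ s, fun s => ?_, h0 _⟩
  refine (h1 _ s (hmem s)).congr_of_eventuallyEq ?_
  filter_upwards [Ioo_mem_nhds (hmem s).1 (hmem s).2] with t ht
  exact huniq _ _ t (hmem t) ht

theorem aux_const {g : ℝ → ℝ} {ε : ℝ} (hε : 0 < ε) (hg : Continuous g)
    (hd : ∀ s, |g s| < ε → HasDerivAt g 0 s) (a : ℝ) (ha : g a = 0) (b : ℝ) : g b = 0 := by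
  have hclopen : IsClopen {s | g s = 0} := by
    refine ⟨isClosed_eq hg continuous_const, ?_⟩
    rw [Metric.isOpen_iff]
    intro s hs
    have hs0 : g s = 0 := hs
    have hop : IsOpen {t | |g t| < ε} := isOpen_lt hg.abs continuous_const
    obtain ⟨δ, hδ, hb⟩ := Metric.isOpen_iff.mp hop s (by simp [hs0, hε])
    refine ⟨δ, hδ, fun t ht => ?_⟩
    have := (convex_ball s δ).norm_image_sub_le_of_norm_hasDerivWithin_le (C := 0)
      (fun u hu => (hd u (hb hu)).hasDerivWithinAt) (by simp) (Metric.mem_ball_self hδ) ht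
    simpa [hs0] using this
  have := hclopen.eq_univ ⟨a, ha⟩
  have hb : b ∈ {s | g s = 0} := by rw [this]; trivial
  exact hb

/-- full statement of Proposition 2.1.
Under the eikonal condition, the zero level sets `{y : r(x,y)=0}` are carried onto each
other by the flow of the ODE `Υ' = F(x, Υ)`, where
`F(x,y) = -(∂ₓ r(x,y)) • ∇_y r(x,y)` is assumed bounded and Lipschitz in `y`
uniformly in `x`. -/
theorem stmt_1 (m : ℕ) (hm : 1 ≤ m) (ε : ℝ) (hε : 0 < ε)
    (r : ℝ → EuclideanSpace ℝ (Fin m) → ℝ)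
    (hr : ContDiff ℝ 1 (fun p : ℝ × EuclideanSpace ℝ (Fin m) => r p.1 p.2))
    (F : ℝ → EuclideanSpace ℝ (Fin m) → EuclideanSpace ℝ (Fin m))
    (hF : ∀ (x : ℝ) (y : EuclideanSpace ℝ (Fin m)),
      F x y = -(deriv (fun x' => r x' y) x) • gradient (r x) y)
    (C : ℝ) (hbd : ∀ x y, ‖F x y‖ ≤ C)
    (L : NNReal) (hLip : ∀ x : ℝ, LipschitzWith L (F x))
    (heik : ∀ (x : ℝ) (y : EuclideanSpace ℝ (Fin m)),
      |r x y| < ε → ‖gradient (r x) y‖ = 1) :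
    ∀ x₀ x : ℝ,
      {y : EuclideanSpace ℝ (Fin m) | r x y = 0} =
        {z : EuclideanSpace ℝ (Fin m) | ∃ U : ℝ → EuclideanSpace ℝ (Fin m),
          (∀ s : ℝ, HasDerivAt U (F s (U s)) s) ∧ r x₀ (U x₀) = 0 ∧ U x = z} := by
  have hdiff : Differentiable ℝ (fun p : ℝ × EuclideanSpace ℝ (Fin m) => r p.1 p.2) :=
    hr.differentiable one_ne_zero
  have hx : ∀ x y, HasDerivAt (fun x' => r x' y)
      (fderiv ℝ (fun p : ℝ × EuclideanSpace ℝ (Fin m) => r p.1 p.2) (x, y) (1, 0)) x := by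
    intro x y
    exact (hdiff (x, y)).hasFDerivAt.comp_hasDerivAt (f := fun x' : ℝ => (x', y)) x
      ((hasDerivAt_id x).prodMk (hasDerivAt_const x y))
  have hy : ∀ x y, HasFDerivAt (r x)
      ((fderiv ℝ (fun p : ℝ × EuclideanSpace ℝ (Fin m) => r p.1 p.2) (x, y)).comp
        (ContinuousLinearMap.inr ℝ ℝ (EuclideanSpace ℝ (Fin m)))) y := by
    intro x y
    exact (hdiff (x, y)).hasFDerivAt.comp (f := fun y' => (x, y')) y (hasFDerivAt_prodMk_right x y)
  have hcd := hr.continuous_fderiv one_ne_zero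
  have hcont : ∀ y, Continuous (fun x => F x y) := by
    intro y
    have e : (fun x => F x y) = fun x =>
      -(fderiv ℝ (fun p : ℝ × EuclideanSpace ℝ (Fin m) => r p.1 p.2) (x, y) (1, 0)) •
        (InnerProductSpace.toDual ℝ (EuclideanSpace ℝ (Fin m))).symm
        ((fderiv ℝ (fun p : ℝ × EuclideanSpace ℝ (Fin m) => r p.1 p.2) (x, y)).comp
        (ContinuousLinearMap.inr ℝ ℝ (EuclideanSpace ℝ (Fin m)))) := by
      funext x
      rw [hF, (hx x y).deriv, gradient, (hy x y).fderiv]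
    rw [e]
    have h1 : Continuous (fun x : ℝ =>
        fderiv ℝ (fun p : ℝ × EuclideanSpace ℝ (Fin m) => r p.1 p.2) (x, y)) :=
      hcd.comp (by fun_prop)
    refine (h1.clm_apply continuous_const).neg.smul ?_
    exact (LinearIsometryEquiv.continuous _).comp (h1.clm_comp continuous_const)
  have key : ∀ U : ℝ → EuclideanSpace ℝ (Fin m), (∀ s : ℝ, HasDerivAt U (F s (U s)) s) →
      ∀ a b, r a (U a) = 0 → r b (U b) = 0 := by
    intro U hU a b ha
    have hg : ∀ s, HasDerivAt (fun s => r s (U s))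
        (fderiv ℝ (fun p : ℝ × EuclideanSpace ℝ (Fin m) => r p.1 p.2) (s, U s) (1, F s (U s)))
        s := fun s =>
      (hdiff (s, U s)).hasFDerivAt.comp_hasDerivAt (f := fun s : ℝ => (s, U s)) s
        ((hasDerivAt_id s).prodMk (hU s))
    refine aux_const (g := fun s => r s (U s)) hε
      (continuous_iff_continuousAt.mpr fun s => (hg s).continuousAt) (fun s hs => ?_) a ha b
    convert hg s using 1
    have hsplit : ((1 : ℝ), F s (U s)) = (1, 0) + ContinuousLinearMap.inr ℝ ℝ _ (F s (U s)) := by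
      simp
    have hgr : ∀ v, fderiv ℝ (fun p : ℝ × EuclideanSpace ℝ (Fin m) => r p.1 p.2) (s, U s)
        (ContinuousLinearMap.inr ℝ ℝ _ v) = ⟪gradient (r s) (U s), v⟫ := by
      intro v
      rw [← ContinuousLinearMap.comp_apply, ← (hy s (U s)).fderiv, ← toDual_gradient,
        InnerProductSpace.toDual_apply_apply]
    rw [hsplit, map_add, hgr, hF, (hx s (U s)).deriv, inner_smul_right,
      real_inner_self_eq_norm_sq, heik s (U s) hs]
    ring
  intro x₀ x
  ext z
  constructor
  · intro hz
    obtain ⟨U, hU, hUx⟩ := aux_global F C hbd L hLip hcont x z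
    refine ⟨U, hU, key U hU x x₀ ?_, hUx⟩
    rw [hUx]; exact hz
  · rintro ⟨U, hU, h0, rfl⟩
    exact key U hU x₀ x h0
end

section
/- Let m ≥ 1, ε > 0, and let r : ℝ × ℝ^m → ℝ be continuously differentiable and satisfy the eikonal condition ‖∇_y r(x,y)‖ = 1 at every point (x,y) with |r(x,y)| < ε. Let Υ : ℝ → ℝ^m be continuously differentiable with Υ'(x) = −(∂_x r(x,Υ(x))) ∇_y r(x,Υ(x)) for all x and r(x₀, Υ(x₀)) = 0. Then Υ is a local geodesic of the family of level surfaces in the following sense: for every continuously differentiable curve θ : ℝ → ℝ^m with r(x, θ(x)) = 0 for all x and θ(x₀) = Υ(x₀), one has limsup_{x → x₀, x ≠ x₀} (1/|x−x₀|) · [L_Υ(x₀,x) − L_θ(x₀,x)] ≤ 0, where for a C¹ curve γ the length is L_γ(x₀,x) := ∫ over [min(x₀,x), max(x₀,x)] of √(1 + ‖γ'(s)‖²) ds. -/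
open scoped RealInnerProductSpace
open MeasureTheory

/-- Euclidean arclength of the graph curve `s ↦ (s, γ s)` between `a` and `b`. -/
noncomputable def arcLen {m : ℕ} (γ : ℝ → EuclideanSpace ℝ (Fin m)) (a b : ℝ) : ℝ :=
  ∫ s in Set.uIcc a b, Real.sqrt (1 + ‖deriv γ s‖ ^ 2)

open Filter Topology in
lemma avg_tendsto (f : ℝ → ℝ) (hf : Continuous f) (x₀ : ℝ) :
    Tendsto (fun x : ℝ => (1 / |x - x₀|) * ∫ s in Set.uIcc x₀ x, f s)
      (𝓝[≠] x₀) (𝓝 (f x₀)) := by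
  have h := (intervalIntegral.integral_hasDerivAt_right (hf.intervalIntegrable x₀ x₀)
    (hf.stronglyMeasurableAtFilter _ _) hf.continuousAt)
  rw [hasDerivAt_iff_tendsto_slope] at h
  refine h.congr' ?_
  filter_upwards [self_mem_nhdsWithin] with x hx
  rw [slope_def_field, intervalIntegral.integral_same, sub_zero]
  rcases le_total x₀ x with hle | hle
  · rw [Set.uIcc_of_le hle, integral_Icc_eq_integral_Ioc, ← intervalIntegral.integral_of_le hle,
      abs_of_nonneg (sub_nonneg.2 hle)]
    ring
  · rw [Set.uIcc_of_ge hle, integral_Icc_eq_integral_Ioc, ← intervalIntegral.integral_of_le hle,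
      abs_of_nonpos (sub_nonpos.2 hle), intervalIntegral.integral_symm, neg_sub, neg_div,
      ← div_neg, neg_sub]
    ring

/-- Proposition 2.4: the normal flow is a local geodesic.
If `Υ` is a `C¹` solution of `Υ'(x) = -(∂ₓ r(x,Υ(x))) • ∇_y r(x,Υ(x))` staying on the
zero level set through `(x₀, Υ x₀)`, then for every `C¹` comparison curve `θ` lying on
the level sets with `θ x₀ = Υ x₀`, one has
`limsup_{x → x₀, x ≠ x₀} (1/|x−x₀|) (L_Υ(x₀,x) − L_θ(x₀,x)) ≤ 0`. -/
theorem stmt_2 (m : ℕ) (hm : 1 ≤ m) (ε : ℝ) (hε : 0 < ε)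
    (r : ℝ → EuclideanSpace ℝ (Fin m) → ℝ)
    (hr : ContDiff ℝ 1 (fun p : ℝ × EuclideanSpace ℝ (Fin m) => r p.1 p.2))
    (heik : ∀ (x : ℝ) (y : EuclideanSpace ℝ (Fin m)),
      |r x y| < ε → ‖gradient (r x) y‖ = 1)
    (U : ℝ → EuclideanSpace ℝ (Fin m)) (hUreg : ContDiff ℝ 1 U)
    (hU : ∀ x : ℝ, deriv U x = -(deriv (fun x' => r x' (U x)) x) • gradient (r x) (U x))
    (x₀ : ℝ) (h₀ : r x₀ (U x₀) = 0)
    (θ : ℝ → EuclideanSpace ℝ (Fin m)) (hθreg : ContDiff ℝ 1 θ)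
    (hθ : ∀ x : ℝ, r x (θ x) = 0) (hθ₀ : θ x₀ = U x₀) :
    Filter.limsup (fun x : ℝ => (1 / |x - x₀|) * (arcLen U x₀ x - arcLen θ x₀ x))
      (nhdsWithin x₀ ({x₀} : Set ℝ)ᶜ) ≤ 0 := by
  have key : ∀ γ : ℝ → EuclideanSpace ℝ (Fin m), ContDiff ℝ 1 γ →
      Filter.Tendsto (fun x : ℝ => (1 / |x - x₀|) * arcLen γ x₀ x)
        (nhdsWithin x₀ ({x₀} : Set ℝ)ᶜ) (nhds (Real.sqrt (1 + ‖deriv γ x₀‖ ^ 2))) := by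
    intro γ hγ
    have hc : Continuous (deriv γ) := hγ.continuous_deriv le_rfl
    exact avg_tendsto (fun s => Real.sqrt (1 + ‖deriv γ s‖ ^ 2)) (by fun_prop) x₀
  have hlim := (key U hUreg).sub (key θ hθreg)
  simp only [← mul_sub] at hlim
  rw [hlim.limsup_eq]
  have hD := (hr.differentiable one_ne_zero (x₀, U x₀)).hasFDerivAt
  set L := fderiv ℝ (fun p : ℝ × EuclideanSpace ℝ (Fin m) => r p.1 p.2) (x₀, U x₀) with hL
  have h1 : HasDerivAt (fun x' => r x' (U x₀)) (L (1, 0)) x₀ :=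
    hD.comp_hasDerivAt (f := fun x' : ℝ => (x', U x₀)) x₀
      ((hasDerivAt_id x₀).prodMk (hasDerivAt_const x₀ (U x₀)))
  have h2 : HasFDerivAt (r x₀) (L.comp ((0 : EuclideanSpace ℝ (Fin m) →L[ℝ] ℝ).prod
      (ContinuousLinearMap.id ℝ _))) (U x₀) :=
    hD.comp (f := fun y : EuclideanSpace ℝ (Fin m) => (x₀, y)) (U x₀)
      ((hasFDerivAt_const x₀ (U x₀)).prodMk (hasFDerivAt_id (U x₀)))
  have hθd : HasDerivAt θ (deriv θ x₀) x₀ :=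
    (hθreg.differentiable one_ne_zero x₀).hasDerivAt
  rw [← hθ₀] at hD
  have h3 : HasDerivAt (fun x => r x (θ x)) (L (1, deriv θ x₀)) x₀ :=
    hD.comp_hasDerivAt (f := fun x' : ℝ => (x', θ x')) x₀ ((hasDerivAt_id x₀).prodMk hθd)
  have h4 : L (1, deriv θ x₀) = 0 := by
    rw [← h3.deriv]
    simp [hθ]
  have hg : ‖gradient (r x₀) (U x₀)‖ = 1 := heik _ _ (by simpa [h₀] using hε)
  have h5 : inner ℝ (gradient (r x₀) (U x₀)) (deriv θ x₀) = L (0, deriv θ x₀) := by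
    rw [gradient, InnerProductSpace.toDual_symm_apply, h2.fderiv]
    simp
  have h6 : L (1, deriv θ x₀) = L (1, 0) + L (0, deriv θ x₀) := by
    rw [← map_add]; simp
  have h7 : ‖deriv U x₀‖ = |L (1, 0)| := by
    rw [hU, norm_smul, hg, h1.deriv]; simp
  have h8 : |L (1, 0)| ≤ ‖deriv θ x₀‖ := by
    have := abs_real_inner_le_norm (gradient (r x₀) (U x₀)) (deriv θ x₀)
    rw [hg, one_mul, h5] at this
    have e : L (1, 0) = -L (0, deriv θ x₀) := by linarith
    rwa [e, abs_neg]
  rw [← h7] at h8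
  rw [sub_nonpos]
  gcongr
end

section
/- Let m ≥ 1 and let D, E ⊆ ℝ^m be nonempty compact convex sets. Then the Hausdorff distance between their topological boundaries equals the Hausdorff distance between the sets themselves: d(frontier D, frontier E) = d(D, E). -/
open Metric Set

theorem seg_frontier {V : Type*} [NormedAddCommGroup V] [NormedSpace ℝ V] {E : Set V} {x y : V}
    (hx : x ∈ E) (hy : y ∉ E) :
    ∃ t : ℝ, 0 ≤ t ∧ t ≤ 1 ∧ x + t • (y - x) ∈ frontier E := by
  have h : (segment ℝ x y ∩ frontier E).Nonempty := by
    by_contra hne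
    have hno : ∀ z ∈ segment ℝ x y, z ∉ frontier E := fun z hz hf => hne ⟨z, hz, hf⟩
    have hcov : ∀ z ∈ segment ℝ x y, z ∈ interior E ∨ z ∈ (closure E)ᶜ := by
      intro z hz
      by_cases h1 : z ∈ interior E
      · exact Or.inl h1
      · exact Or.inr fun h2 => hno z hz ⟨h2, h1⟩
    have hxs := left_mem_segment ℝ x y
    have hys := right_mem_segment ℝ x y
    obtain ⟨z, _, hz1, hz2⟩ := (convex_segment (𝕜 := ℝ) x y).isPreconnected (interior E)
      (closure E)ᶜ isOpen_interior isClosed_closure.isOpen_compl hcov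
      ⟨x, hxs, (hcov x hxs).resolve_right fun h => h (subset_closure hx)⟩
      ⟨y, hys, (hcov y hys).resolve_left fun h => hy (interior_subset h)⟩
    exact hz2 (subset_closure (interior_subset hz1))
  obtain ⟨z, hz, hzE⟩ := h
  rw [segment_eq_image'] at hz
  obtain ⟨t, ht, rfl⟩ := hz
  exact ⟨t, ht.1, ht.2, hzE⟩

theorem ray_frontier {V : Type*} [NormedAddCommGroup V] [NormedSpace ℝ V] {E : Set V} {x v : V}
    (hE : Bornology.IsBounded E) (hx : x ∈ E) (hv : v ≠ 0) :
    ∃ t : ℝ, 0 ≤ t ∧ x + t • v ∈ frontier E := by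
  obtain ⟨R, hR⟩ := hE.subset_closedBall x
  have hvn : 0 < ‖v‖ := norm_pos_iff.2 hv
  have hR0 : 0 ≤ R := by simpa using hR hx
  have hT : 0 ≤ (R + 1) / ‖v‖ := by positivity
  have hy : x + ((R + 1) / ‖v‖) • v ∉ E := by
    intro h
    have := hR h
    rw [mem_closedBall, dist_eq_norm, add_sub_cancel_left, norm_smul, Real.norm_of_nonneg hT,
      div_mul_cancel₀ _ hvn.ne'] at this
    linarith
  obtain ⟨t, h0, _, h⟩ := seg_frontier hx hy
  refine ⟨t * ((R + 1) / ‖v‖), by positivity, ?_⟩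
  rwa [add_sub_cancel_left, smul_smul] at h

theorem mem_cth {V : Type*} [PseudoMetricSpace V] {E : Set V} (hE : E.Nonempty) {r : ℝ} (hr : 0 ≤ r)
    {x : V} : x ∈ cthickening r E ↔ infDist x E ≤ r := by
  rw [mem_cthickening_iff, infDist, ENNReal.le_ofReal_iff_toReal_le (infEDist_ne_top hE) hr]

theorem part_one {V : Type*} [NormedAddCommGroup V] [NormedSpace ℝ V] [Nontrivial V] {D E : Set V}
    (hD : IsCompact D) (hE : IsCompact E) (hEne : E.Nonempty) (hEc : Convex ℝ E)
    (hfin : hausdorffEDist (frontier D) (frontier E) ≠ ⊤) (hfE : (frontier E).Nonempty)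
    {x : V} (hx : x ∈ D) :
    infDist x E ≤ hausdorffDist (frontier D) (frontier E) := by
  obtain ⟨v, hv⟩ := exists_ne (0 : V)
  obtain ⟨a, ha0, ha⟩ := ray_frontier hD.isBounded hx hv
  obtain ⟨b, hb0, hb⟩ := ray_frontier hD.isBounded hx (neg_ne_zero.2 hv)
  have key : ∀ y ∈ frontier D, y ∈ cthickening (hausdorffDist (frontier D) (frontier E)) E := by
    intro y hy
    rw [mem_cth hEne hausdorffDist_nonneg]
    exact (infDist_le_infDist_of_subset hE.isClosed.frontier_subset hfE).trans
      (infDist_le_hausdorffDist_of_mem hy hfin)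
  have hc : Convex ℝ (cthickening (hausdorffDist (frontier D) (frontier E)) E) := hEc.cthickening _
  have hxm : x ∈ cthickening (hausdorffDist (frontier D) (frontier E)) E := by
    rcases eq_or_lt_of_le (add_nonneg ha0 hb0) with h | h
    · have : a = 0 := by linarith
      subst this
      simpa using key _ ha
    · have := hc (key _ ha) (key _ hb) (a := b / (a + b)) (b := a / (a + b)) (by positivity)
        (by positivity) (by field_simp; ring)
      convert this using 1
      match_scalars
      · field_simp; ring
      · field_simp; ring
  rw [mem_cth hEne hausdorffDist_nonneg] at hxm
  exact hxm

theorem part_two {V : Type*} [NormedAddCommGroup V] [InnerProductSpace ℝ V] [CompleteSpace V]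
    {D E : Set V}
    (hD : IsCompact D) (hDne : D.Nonempty) (hE : IsCompact E) (hEne : E.Nonempty)
    (hDc : Convex ℝ D) (hfin : hausdorffEDist D E ≠ ⊤)
    {x : V} (hx : x ∈ frontier D) :
    infDist x (frontier E) ≤ hausdorffDist D E := by
  have hfin' : hausdorffEDist E D ≠ ⊤ := by rwa [hausdorffEDist_comm]
  have hxD := hD.isClosed.frontier_subset hx
  have step : ∀ x' ∉ D, infDist x' (frontier E) ≤ hausdorffDist D E + dist x' x := by
    intro x' hx'
    by_cases hxE : x' ∈ E
    · obtain ⟨f, u, hfu, hux⟩ := geometric_hahn_banach_closed_point hDc hD.isClosed hx'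
      set w := (InnerProductSpace.toDual ℝ V).symm f with hw
      have hwf : ∀ z, inner ℝ w z = f z := fun z => by simp [hw]
      have hw0 : w ≠ 0 := by
        intro h0
        have h1 := hfu x hxD
        have h2 := hwf x
        have h3 := hwf x'
        rw [h0, inner_zero_left] at h2 h3
        linarith
      have hwn : 0 < ‖w‖ := norm_pos_iff.2 hw0
      obtain ⟨t, ht0, ht⟩ := ray_frontier hE.isBounded hxE hw0
      have hd : dist x' (x' + t • w) = t * ‖w‖ := by
        rw [dist_self_add_right, norm_smul, Real.norm_of_nonneg ht0]
      have h1 : t * ‖w‖ ≤ infDist (x' + t • w) D := by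
        rw [le_infDist hDne]
        intro y hy
        have hy1 := hfu y hy
        have h2 : inner ℝ w (x' + t • w - y) ≤ ‖w‖ * ‖x' + t • w - y‖ := real_inner_le_norm _ _
        rw [inner_sub_right, inner_add_right, inner_smul_right, hwf x', hwf y,
          real_inner_self_eq_norm_sq] at h2
        rw [dist_eq_norm]
        refine le_of_mul_le_mul_left ?_ hwn
        nlinarith
      have h2 := infDist_le_hausdorffDist_of_mem (hE.isClosed.frontier_subset ht) hfin'
      rw [hausdorffDist_comm] at h2
      have h3 := infDist_le_dist_of_mem (x := x') ht
      have := dist_nonneg (x := x') (y := x)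
      linarith
    · obtain ⟨e, he, hed⟩ := hE.exists_infDist_eq_dist hEne x'
      obtain ⟨t, ht0, ht1, ht⟩ := seg_frontier he hxE
      have h1 := infDist_le_dist_of_mem (x := x') ht
      have h2 : dist x' (e + t • (x' - e)) ≤ dist x' e := by
        rw [dist_eq_norm, dist_eq_norm,
          show x' - (e + t • (x' - e)) = (1 - t) • (x' - e) by module, norm_smul,
          Real.norm_of_nonneg (by linarith)]
        nlinarith [norm_nonneg (x' - e)]
      have h3 := infDist_le_hausdorffDist_of_mem hxD hfin
      have h4 := infDist_le_infDist_add_dist (s := E) (x := x') (y := x)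
      linarith
  refine le_of_forall_pos_le_add fun ε hε => ?_
  have hxc : x ∈ closure Dᶜ := by
    rw [frontier_eq_closure_inter_closure] at hx
    exact hx.2
  obtain ⟨x', hx', hd⟩ := Metric.mem_closure_iff.1 hxc (ε / 2) (by positivity)
  have h1 := step x' hx'
  have h2 := infDist_le_infDist_add_dist (s := frontier E) (x := x) (y := x')
  rw [dist_comm x' x] at h1
  linarith

/-- Lemma A.1 (i). For nonempty compact convex sets `D, E ⊆ ℝ^m`,
the Hausdorff distance between their topological boundaries equals the Hausdorff
distance between the sets themselves. -/
theorem stmt_5 (m : ℕ) (hm : 1 ≤ m) (D E : Set (EuclideanSpace ℝ (Fin m)))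
    (hDne : D.Nonempty) (hEne : E.Nonempty)
    (hDc : IsCompact D) (hEc : IsCompact E)
    (hDconv : Convex ℝ D) (hEconv : Convex ℝ E) :
    Metric.hausdorffDist (frontier D) (frontier E) = Metric.hausdorffDist D E := by
  have : Nonempty (Fin m) := ⟨⟨0, hm⟩⟩
  have hfr : ∀ S : Set (EuclideanSpace ℝ (Fin m)), S.Nonempty → IsCompact S →
      (frontier S).Nonempty := by
    rintro S ⟨x, hx⟩ hS
    obtain ⟨v, hv⟩ := exists_ne (0 : EuclideanSpace ℝ (Fin m))
    obtain ⟨t, _, ht⟩ := ray_frontier hS.isBounded hx hv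
    exact ⟨_, ht⟩
  have hD' := hfr D hDne hDc
  have hE' := hfr E hEne hEc
  have hbD := hDc.isBounded.subset hDc.isClosed.frontier_subset
  have hbE := hEc.isBounded.subset hEc.isClosed.frontier_subset
  have f1 : hausdorffEDist D E ≠ ⊤ :=
    hausdorffEDist_ne_top_of_nonempty_of_bounded hDne hEne hDc.isBounded hEc.isBounded
  have f2 : hausdorffEDist (frontier D) (frontier E) ≠ ⊤ :=
    hausdorffEDist_ne_top_of_nonempty_of_bounded hD' hE' hbD hbE
  apply le_antisymm
  · refine hausdorffDist_le_of_infDist hausdorffDist_nonneg ?_ ?_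
    · intro x hx
      exact part_two hDc hDne hEc hEne hDconv f1 hx
    · intro x hx
      rw [hausdorffDist_comm]
      exact part_two hEc hEne hDc hDne hEconv (by rwa [hausdorffEDist_comm]) hx
  · refine hausdorffDist_le_of_infDist hausdorffDist_nonneg ?_ ?_
    · intro x hx
      exact part_one hDc hEc hEne hEconv f2 hE' hx
    · intro x hx
      rw [hausdorffDist_comm]
      exact part_one hEc hDc hDne hDconv (by rwa [hausdorffEDist_comm]) hD' hx
end

section
/- Let m ≥ 1 and let D, E ⊆ ℝ^m be nonempty compact convex sets. Then for every y ∈ D, dist(y, E) ≤ d(frontier D, frontier E); consequently sup_{y∈D} dist(y, E) ≤ d(frontier D, frontier E). -/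
theorem aux_max {V : Type*} [NormedAddCommGroup V] [InnerProductSpace ℝ V]
    (D : Set V) (hDne : D.Nonempty) (hDc : IsCompact D) (u : V) (hu : u ≠ 0) :
    ∃ z ∈ frontier D, ∀ y ∈ D, inner ℝ u y ≤ inner ℝ u z := by
  obtain ⟨z, hz, hmax⟩ := hDc.exists_isMaxOn hDne
    (f := fun y => inner ℝ u y) (by fun_prop)
  have hmax' : ∀ y ∈ D, inner ℝ u y ≤ inner ℝ u z := fun y hy => hmax hy
  refine ⟨z, ⟨subset_closure hz, fun hint => ?_⟩, hmax'⟩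
  have hc : Filter.Tendsto (fun t : ℝ => z + t • u) (nhdsWithin 0 (Set.Ioi 0)) (nhds z) := by
    have : Continuous (fun t : ℝ => z + t • u) := by fun_prop
    have h := this.tendsto 0
    simp only [zero_smul, add_zero] at h
    exact h.mono_left nhdsWithin_le_nhds
  have h1 := hc.eventually (mem_interior_iff_mem_nhds.mp hint)
  obtain ⟨t, ht, ht0⟩ := (h1.and self_mem_nhdsWithin).exists
  have h2 := hmax' _ ht
  rw [inner_add_right, inner_smul_right] at h2
  have h3 : 0 < inner ℝ u u := real_inner_self_pos.mpr hu
  have h4 : 0 < t * inner ℝ u u := mul_pos ht0 h3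
  linarith

/-- Step 1 of the proof of Lemma A.1 (i). For nonempty compact convex
sets `D, E ⊆ ℝ^m`, every point of `D` is within Hausdorff distance of the boundaries
from `E`: `dist(y, E) ≤ d(frontier D, frontier E)` for all `y ∈ D`; consequently
`sup_{y ∈ D} dist(y, E) ≤ d(frontier D, frontier E)`. -/
theorem stmt_7 (m : ℕ) (hm : 1 ≤ m) (D E : Set (EuclideanSpace ℝ (Fin m)))
    (hDne : D.Nonempty) (hEne : E.Nonempty)
    (hDc : IsCompact D) (hEc : IsCompact E)
    (hDconv : Convex ℝ D) (hEconv : Convex ℝ E) :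
    (∀ y ∈ D, Metric.infDist y E ≤ Metric.hausdorffDist (frontier D) (frontier E)) ∧
    (⨆ y : D, Metric.infDist (y : EuclideanSpace ℝ (Fin m)) E) ≤
      Metric.hausdorffDist (frontier D) (frontier E) := by
  have key : ∀ y ∈ D, Metric.infDist y E ≤
      Metric.hausdorffDist (frontier D) (frontier E) := by
    intro y hy
    obtain ⟨p, hp, hpe⟩ := exists_norm_eq_iInf_of_complete_convex hEne hEc.isComplete hEconv y
    rw [norm_eq_iInf_iff_real_inner_le_zero hEconv hp] at hpe
    have hle : Metric.infDist y E ≤ ‖y - p‖ := by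
      rw [← dist_eq_norm]; exact Metric.infDist_le_dist_of_mem hp
    by_cases hu : y - p = 0
    · rw [hu, norm_zero] at hle
      exact hle.trans Metric.hausdorffDist_nonneg
    obtain ⟨z, hz, hzm⟩ := aux_max D hDne hDc (y - p) hu
    obtain ⟨w, hw, -⟩ := aux_max E hEne hEc (y - p) hu
    have hfE : frontier E ⊆ E := hEc.isClosed.frontier_subset
    have hfD : frontier D ⊆ D := hDc.isClosed.frontier_subset
    have hfin : Metric.hausdorffEDist (frontier D) (frontier E) ≠ ⊤ :=
      Metric.hausdorffEDist_ne_top_of_nonempty_of_bounded ⟨z, hz⟩ ⟨w, hw⟩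
        (hDc.isBounded.subset hfD) (hEc.isBounded.subset hfE)
    refine hle.trans (le_trans ?_ (Metric.infDist_le_hausdorffDist_of_mem hz hfin))
    rw [Metric.le_infDist ⟨w, hw⟩]
    intro e he
    rw [dist_eq_norm]
    have h1 := hpe e (hfE he)
    have h2 := hzm y hy
    have h3 : inner ℝ (y - p) (z - e) ≤ ‖y - p‖ * ‖z - e‖ := real_inner_le_norm _ _
    have h4 : inner ℝ (y - p) (y - p) = ‖y - p‖ * ‖y - p‖ := real_inner_self_eq_norm_mul_norm _
    have h5 : 0 < ‖y - p‖ := norm_pos_iff.mpr hu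
    rw [inner_sub_right] at h1 h3 h4
    refine le_of_mul_le_mul_left ?_ h5
    linarith
  haveI : Nonempty D := hDne.to_subtype
  exact ⟨key, ciSup_le fun y => key y y.2⟩
end

section
/- Let m ≥ 1 and let D, E ⊆ ℝ^m be nonempty compact convex sets. Then for every y ∈ frontier D, dist(y, frontier E) ≤ d(D, E). -/
/-- Step 2 of the proof of Lemma A.1 (i). For nonempty compact convex
sets `D, E ⊆ ℝ^m`, every boundary point of `D` is within Hausdorff distance of the sets
from the boundary of `E`: `dist(y, frontier E) ≤ d(D, E)` for all `y ∈ frontier D`. -/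
theorem stmt_8 (m : ℕ) (hm : 1 ≤ m) (D E : Set (EuclideanSpace ℝ (Fin m)))
    (hDne : D.Nonempty) (hEne : E.Nonempty)
    (hDc : IsCompact D) (hEc : IsCompact E)
    (hDconv : Convex ℝ D) (hEconv : Convex ℝ E) :
    ∀ y ∈ frontier D, Metric.infDist y (frontier E) ≤ Metric.hausdorffDist D E := by
  intro y hy
  have hyD : y ∈ D := hDc.isClosed.frontier_subset hy
  have hfin : Metric.hausdorffEDist D E ≠ ⊤ :=
    Metric.hausdorffEDist_ne_top_of_nonempty_of_bounded hDne hEne hDc.isBounded hEc.isBounded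
  by_cases hyE : y ∈ E
  · haveI : Nonempty (Fin m) := ⟨⟨0, hm⟩⟩
    haveI : Nontrivial (EuclideanSpace ℝ (Fin m)) := inferInstance
    obtain ⟨w, hw, hdw⟩ := hEc.exists_mem_frontier_infDist_compl_eq_dist hyE
    refine (Metric.infDist_le_dist_of_mem hw).trans ?_
    by_contra! hlt
    set h := Metric.hausdorffDist D E with hh
    set r := dist y w with hr
    have hh0 : 0 ≤ h := Metric.hausdorffDist_nonneg
    have hyc : y ∈ closure Dᶜ := by
      rw [frontier_eq_closure_inter_closure] at hy
      exact hy.2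
    obtain ⟨y', hy', hyy'⟩ := Metric.mem_closure_iff.1 hyc ((r - h) / 2) (by linarith)
    obtain ⟨f, c, hfD, hfc⟩ := geometric_hahn_banach_closed_point hDconv hDc.isClosed hy'
    set v := (InnerProductSpace.toDual ℝ (EuclideanSpace ℝ (Fin m))).symm f with hv
    have hfv : ∀ x, f x = inner ℝ v x := fun x => by simp [hv]
    have hv0 : v ≠ 0 := by
      intro h0
      have h1 := hfD y hyD
      rw [hfv, h0, inner_zero_left] at h1
      rw [hfv, h0, inner_zero_left] at hfc
      linarith
    have hvn : 0 < ‖v‖ := norm_pos_iff.2 hv0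
    set t := (h + r) / 2 with ht
    have ht0 : 0 < t := by linarith
    set q := y' + (t / ‖v‖) • v with hq
    have hqd : dist y' q = t := by
      rw [hq, dist_self_add_right, norm_smul, Real.norm_of_nonneg (by positivity)]
      field_simp
    have hqE : q ∈ E := by
      by_contra hn
      have h1 := Metric.infDist_le_dist_of_mem (x := y) (s := Eᶜ) hn
      have h2 := dist_triangle y y' q
      linarith
    have hqh : Metric.infDist q D ≤ h := by
      rw [hh, Metric.hausdorffDist_comm]
      exact Metric.infDist_le_hausdorffDist_of_mem hqE (by rwa [Metric.hausdorffEDist_comm])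
    obtain ⟨x, hxD, hx⟩ := hDc.exists_infDist_eq_dist hDne q
    have h1 : inner ℝ v (q - x) ≤ ‖v‖ * ‖q - x‖ := real_inner_le_norm _ _
    have h2 : inner ℝ v (q - x) = inner ℝ v y' - inner ℝ v x + t * ‖v‖ := by
      rw [hq, inner_sub_right, inner_add_right, inner_smul_right, real_inner_self_eq_norm_sq]
      field_simp
      ring
    have h3 := hfD x hxD
    rw [hfv] at h3 hfc
    rw [dist_eq_norm] at hx
    have h4 : ‖v‖ * ‖q - x‖ ≤ ‖v‖ * t :=
      mul_le_mul_of_nonneg_left (by linarith) hvn.le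
    linarith
  · obtain ⟨z, hzE, hz⟩ := hEc.exists_infDist_eq_dist hEne y
    have hpre : IsPreconnected (segment ℝ y z) := (convex_segment y z).isPreconnected
    obtain ⟨w, hws, hwf⟩ : (segment ℝ y z ∩ frontier E).Nonempty := by
      by_contra hne
      rw [Set.not_nonempty_iff_eq_empty] at hne
      have := hpre.subset_or_subset (u := interior E) (v := Eᶜ) isOpen_interior
        hEc.isClosed.isOpen_compl
        (Set.disjoint_left.2 fun a ha hb => hb (interior_subset ha))
        (fun a ha => by
          by_cases haE : a ∈ E
          · left
            by_contra hai
            have : a ∈ segment ℝ y z ∩ frontier E := ⟨ha, subset_closure haE, hai⟩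
            rw [hne] at this
            exact this
          · exact Or.inr haE)
      rcases this with h | h
      · exact hyE (interior_subset (h (left_mem_segment ℝ y z)))
      · exact h (right_mem_segment ℝ y z) hzE
    calc Metric.infDist y (frontier E) ≤ dist y w := Metric.infDist_le_dist_of_mem hwf
      _ ≤ dist y z := by
          have := dist_add_dist_of_mem_segment hws
          have := dist_nonneg (x := w) (y := z)
          linarith
      _ = Metric.infDist y E := hz.symm
      _ ≤ _ := Metric.infDist_le_hausdorffDist_of_mem hyD hfin
end

section
/- Convexity is essential in Lemma A.1: let D := {p ∈ ℝ² : ‖p‖ ≤ 1} be the closed unit disc and, for 0 < ε < π/2, let D̃_ε := { (ρ cos θ, ρ sin θ) : 0 ≤ ρ ≤ 1, ε ≤ θ ≤ 2π − ε }. Then d(D, D̃_ε) ≤ 2ε, so d(D, D̃_ε) → 0 as ε → 0, while d(frontier D, frontier D̃_ε) ≥ 1 for every such ε (indeed the origin lies in frontier D̃_ε and dist(0, frontier D) = dist(0, unit circle) = 1). -/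
open Filter

/-- The point `(a, b)` of the Euclidean plane. -/
noncomputable def pt2 (a b : ℝ) : EuclideanSpace ℝ (Fin 2) :=
  (EuclideanSpace.equiv (Fin 2) ℝ).symm ![a, b]

/-- The closed unit disc with the angular sector `(-ε, ε)` removed:
`D̃_ε = { ρ(cos θ, sin θ) : 0 ≤ ρ ≤ 1, ε ≤ θ ≤ 2π − ε }`. -/
def slitDisc (ε : ℝ) : Set (EuclideanSpace ℝ (Fin 2)) :=
  {p | ∃ ρ θ : ℝ, 0 ≤ ρ ∧ ρ ≤ 1 ∧ ε ≤ θ ∧ θ ≤ 2 * Real.pi - ε ∧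
    p = pt2 (ρ * Real.cos θ) (ρ * Real.sin θ)}

lemma norm_pt2_sq (a b : ℝ) : ‖pt2 a b‖ ^ 2 = a ^ 2 + b ^ 2 := by
  simp [pt2, EuclideanSpace.norm_sq_eq, Fin.sum_univ_two]

lemma pt2_sub (a b c d : ℝ) : pt2 a b - pt2 c d = pt2 (a - c) (b - d) := by
  ext i
  fin_cases i <;> simp [pt2]

lemma exists_polar (p : EuclideanSpace ℝ (Fin 2)) :
    ∃ ρ t : ℝ, ρ = ‖p‖ ∧ -Real.pi < t ∧ t ≤ Real.pi ∧
      p = pt2 (ρ * Real.cos t) (ρ * Real.sin t) := by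
  set z : ℂ := ⟨p 0, p 1⟩ with hz
  have hp : p = pt2 (‖z‖ * Real.cos z.arg) (‖z‖ * Real.sin z.arg) := by
    rw [Complex.norm_mul_cos_arg, Complex.norm_mul_sin_arg]
    ext i
    fin_cases i <;> simp [pt2, hz]
  refine ⟨‖z‖, z.arg, ?_, Complex.neg_pi_lt_arg z, Complex.arg_le_pi z, hp⟩
  have h := norm_pt2_sq (‖z‖ * Real.cos z.arg) (‖z‖ * Real.sin z.arg)
  rw [← hp] at h
  have h2 : ‖p‖ ^ 2 = ‖z‖ ^ 2 := by
    rw [h]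
    linear_combination ‖z‖ ^ 2 * Real.sin_sq_add_cos_sq z.arg
  exact ((sq_eq_sq₀ (norm_nonneg _) (norm_nonneg _)).1 h2).symm

lemma dist_polar (ρ s t : ℝ) (h0 : 0 ≤ ρ) (h1 : ρ ≤ 1) :
    dist (pt2 (ρ * Real.cos s) (ρ * Real.sin s)) (pt2 (ρ * Real.cos t) (ρ * Real.sin t))
      ≤ |s - t| := by
  rw [dist_eq_norm, pt2_sub]
  apply abs_le_of_sq_le_sq' _ (abs_nonneg _) |>.2
  rw [norm_pt2_sq, sq_abs]
  have hc := Real.one_sub_sq_div_two_le_cos (x := s - t)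
  have hc1 := Real.cos_le_one (s - t)
  have e : (ρ * Real.cos s - ρ * Real.cos t) ^ 2 + (ρ * Real.sin s - ρ * Real.sin t) ^ 2
      = ρ ^ 2 * (2 - 2 * Real.cos (s - t)) := by
    rw [Real.cos_sub]
    linear_combination ρ ^ 2 * Real.sin_sq_add_cos_sq s + ρ ^ 2 * Real.sin_sq_add_cos_sq t
  rw [e]
  have : ρ ^ 2 ≤ 1 := by nlinarith
  nlinarith

lemma slitDisc_subset (ε : ℝ) : slitDisc ε ⊆ Metric.closedBall 0 1 := by
  rintro p ⟨ρ, θ, h0, h1, -, -, rfl⟩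
  rw [mem_closedBall_zero_iff]
  apply abs_le_of_sq_le_sq' _ zero_le_one |>.2
  rw [norm_pt2_sq]
  have := Real.sin_sq_add_cos_sq θ
  have e : (ρ * Real.cos θ) ^ 2 + (ρ * Real.sin θ) ^ 2 = ρ ^ 2 := by
    linear_combination ρ ^ 2 * this
  rw [e]
  nlinarith

lemma hd_le (ε : ℝ) (h : 0 < ε) (h' : ε < Real.pi / 2) :
    Metric.hausdorffDist (Metric.closedBall (0 : EuclideanSpace ℝ (Fin 2)) 1)
          (slitDisc ε) ≤ 2 * ε := by
  apply Metric.hausdorffDist_le_of_mem_dist (by linarith)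
  · intro p hp
    obtain ⟨ρ, t, hρ, ht1, ht2, rfl⟩ := exists_polar p
    rw [mem_closedBall_zero_iff, ← hρ] at hp
    have h0 : 0 ≤ ρ := hρ ▸ norm_nonneg _
    by_cases c1 : ε ≤ t
    · exact ⟨_, ⟨ρ, t, h0, hp, c1, by linarith, rfl⟩, by rw [dist_self]; linarith⟩
    by_cases c2 : t ≤ -ε
    · refine ⟨_, ⟨ρ, t + 2 * Real.pi, h0, hp, by linarith, by linarith, rfl⟩, ?_⟩
      rw [Real.cos_add_two_pi, Real.sin_add_two_pi, dist_self]
      linarith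
    · refine ⟨_, ⟨ρ, ε, h0, hp, le_rfl, by linarith, rfl⟩, ?_⟩
      refine (dist_polar ρ t ε h0 hp).trans ?_
      rw [abs_le]
      constructor <;> linarith
  · intro p hp
    exact ⟨p, slitDisc_subset ε hp, by rw [dist_self]; linarith⟩

lemma zero_mem_fr (ε : ℝ) (h : 0 < ε) (h' : ε < Real.pi / 2) :
    (0 : EuclideanSpace ℝ (Fin 2)) ∈ frontier (slitDisc ε) := by
  have hz : pt2 0 0 = 0 := by
    ext i
    fin_cases i <;> simp [pt2]
  refine ⟨subset_closure ⟨0, ε, le_rfl, zero_le_one, le_rfl, by linarith, by simp [hz]⟩, ?_⟩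
  intro hi
  rw [mem_interior_iff_mem_nhds, Metric.mem_nhds_iff] at hi
  obtain ⟨r, hr, hb⟩ := hi
  have hm : pt2 (r / 2) 0 ∈ Metric.ball (0 : EuclideanSpace ℝ (Fin 2)) r := by
    rw [mem_ball_zero_iff]
    apply abs_lt_of_sq_lt_sq' _ hr.le |>.2
    rw [norm_pt2_sq]
    nlinarith
  obtain ⟨ρ, θ, h0, h1, hθ1, hθ2, e⟩ := hb hm
  have e0 : r / 2 = ρ * Real.cos θ := by
    simpa [pt2] using congrArg (fun v : EuclideanSpace ℝ (Fin 2) => v 0) e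
  have e1 : 0 = ρ * Real.sin θ := by
    simpa [pt2] using congrArg (fun v : EuclideanSpace ℝ (Fin 2) => v 1) e
  have hρ : ρ ≠ 0 := by
    rintro rfl
    linarith
  have hs : Real.sin θ = 0 := by
    rcases mul_eq_zero.1 e1.symm with h | h
    · exact absurd h hρ
    · exact h
  have hc : 0 < Real.cos θ := by
    by_contra hn
    nlinarith
  have hc1 : Real.cos θ = 1 := by
    have := Real.sin_sq_add_cos_sq θ
    rw [hs] at this
    nlinarith
  have := (Real.cos_eq_one_iff_of_lt_of_lt (by linarith) (by linarith)).1 hc1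
  linarith

lemma frontier_disc : frontier (Metric.closedBall (0 : EuclideanSpace ℝ (Fin 2)) 1)
    = Metric.sphere 0 1 := frontier_closedBall _ one_ne_zero

lemma sphere_ne : (Metric.sphere (0 : EuclideanSpace ℝ (Fin 2)) 1).Nonempty :=
  NormedSpace.sphere_nonempty.2 zero_le_one

lemma infDist_sphere : Metric.infDist (0 : EuclideanSpace ℝ (Fin 2))
    (Metric.sphere (0 : EuclideanSpace ℝ (Fin 2)) 1) = 1 := by
  apply le_antisymm
  · obtain ⟨x, hx⟩ := sphere_ne
    refine (Metric.infDist_le_dist_of_mem hx).trans ?_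
    rw [dist_comm]
    exact hx.le
  · rw [Metric.le_infDist sphere_ne]
    intro y hy
    rw [dist_comm]
    exact hy.ge

/-- the example after Lemma A.1: convexity is essential. With `D` the
closed unit disc and `D̃_ε` the slit disc, `d(D, D̃_ε) ≤ 2ε` (so `d(D, D̃_ε) → 0` as
`ε → 0⁺`), while `d(frontier D, frontier D̃_ε) ≥ 1` for every `0 < ε < π/2`; indeed the
origin lies in `frontier D̃_ε` and `dist(0, frontier D) = 1`. -/
theorem stmt_9 :
    (∀ ε : ℝ, 0 < ε → ε < Real.pi / 2 →
      Metric.hausdorffDist (Metric.closedBall (0 : EuclideanSpace ℝ (Fin 2)) 1)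
          (slitDisc ε) ≤ 2 * ε ∧
      1 ≤ Metric.hausdorffDist
          (frontier (Metric.closedBall (0 : EuclideanSpace ℝ (Fin 2)) 1))
          (frontier (slitDisc ε)) ∧
      (0 : EuclideanSpace ℝ (Fin 2)) ∈ frontier (slitDisc ε) ∧
      Metric.infDist (0 : EuclideanSpace ℝ (Fin 2))
          (frontier (Metric.closedBall (0 : EuclideanSpace ℝ (Fin 2)) 1)) = 1) ∧
    Tendsto
      (fun ε : ℝ => Metric.hausdorffDist
        (Metric.closedBall (0 : EuclideanSpace ℝ (Fin 2)) 1) (slitDisc ε))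
      (nhdsWithin 0 (Set.Ioo 0 (Real.pi / 2))) (nhds 0) := by
  refine ⟨fun ε h h' => ⟨hd_le ε h h', ?_, zero_mem_fr ε h h', ?_⟩, ?_⟩
  · rw [frontier_disc, Metric.hausdorffDist_comm]
    have hz := zero_mem_fr ε h h'
    have hb : Bornology.IsBounded (frontier (slitDisc ε)) :=
      (Metric.isBounded_closedBall.subset (slitDisc_subset ε)).closure.subset
        frontier_subset_closure
    have := Metric.infDist_le_hausdorffDist_of_mem hz
      (Metric.hausdorffEDist_ne_top_of_nonempty_of_bounded ⟨_, hz⟩ sphere_ne hb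
        Metric.isBounded_sphere)
    rwa [infDist_sphere] at this
  · rw [frontier_disc, infDist_sphere]
  · have ht : Tendsto (fun ε : ℝ => 2 * ε) (nhdsWithin 0 (Set.Ioo 0 (Real.pi / 2)))
        (nhds 0) := by
      have : Tendsto (fun ε : ℝ => 2 * ε) (nhds 0) (nhds (2 * 0)) :=
        (continuous_const.mul continuous_id).tendsto 0
      rw [mul_zero] at this
      exact this.mono_left nhdsWithin_le_nhds
    refine tendsto_of_tendsto_of_tendsto_of_le_of_le' tendsto_const_nhds ht
      (Eventually.of_forall fun _ => Metric.hausdorffDist_nonneg) ?_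
    filter_upwards [self_mem_nhdsWithin] with ε hε
    exact hd_le ε hε.1 hε.2
end

section
/- For T > 0 define D_T := { (z₁, z₂) ∈ ℝ² : z₁² ≤ T² and z₂² ≤ (1 + z₁²)² (T² − z₁²) }. Then D_T is a convex subset of ℝ² if and only if T ≤ 1/√2. -/
/-- Example 4.3. The set
`D_T = { (z₁, z₂) : z₁² ≤ T², z₂² ≤ (1 + z₁²)² (T² − z₁²) }`
is convex if and only if `T ≤ 1/√2`. -/
theorem stmt_13 (T : ℝ) (hT : 0 < T) :
    Convex ℝ {z : ℝ × ℝ | z.1 ^ 2 ≤ T ^ 2 ∧ z.2 ^ 2 ≤ (1 + z.1 ^ 2) ^ 2 * (T ^ 2 - z.1 ^ 2)}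
      ↔ T ≤ 1 / Real.sqrt 2 := by
  have h2 : (0 : ℝ) < Real.sqrt 2 := by positivity
  have hsq : Real.sqrt 2 ^ 2 = 2 := Real.sq_sqrt (by norm_num)
  have key : T ≤ 1 / Real.sqrt 2 ↔ T ^ 2 ≤ 1 / 2 := by
    rw [← sq_le_sq₀ hT.le (by positivity), div_pow, hsq, one_pow]
  rw [key]
  generalize ha : T ^ 2 = a
  have ha0 : 0 < a := by rw [← ha]; positivity
  constructor
  · intro hc
    by_contra hlt
    push Not at hlt
    obtain ⟨v, hv0, hv1, hva, hvd⟩ : ∃ v : ℝ, 0 < v ∧ v ≤ 1 ∧ v ≤ a ∧ 5 / 2 * v < 2 * a - 1 := by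
      have hd : 0 < 2 * a - 1 := by linarith
      refine ⟨(2 * a - 1) / (3 + (2 * a - 1)), by positivity, ?_, ?_, ?_⟩
      · rw [div_le_one (by positivity)]; linarith
      · rw [div_le_iff₀ (by positivity)]; nlinarith
      · rw [← mul_div_assoc, div_lt_iff₀ (by positivity)]; nlinarith
    have hu : Real.sqrt v ^ 2 = v := Real.sq_sqrt hv0.le
    have hs : Real.sqrt (a - v) ^ 2 = a - v := Real.sq_sqrt (by linarith)
    have hp := @hc (Real.sqrt v, (1 + v) * Real.sqrt (a - v))
      (by simp only [Set.mem_ofPred_eq, hu, mul_pow, hs]; exact ⟨hva, le_rfl⟩)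
      (-Real.sqrt v, (1 + v) * Real.sqrt (a - v))
      (by simp only [Set.mem_ofPred_eq, neg_sq, hu, mul_pow, hs]; exact ⟨hva, le_rfl⟩)
      (1 / 2) (1 / 2) (by norm_num) (by norm_num) (by norm_num)
    have h3 := hp.2
    simp only [Prod.smul_mk, Prod.mk_add_mk, smul_eq_mul] at h3
    have e1 : 1 / 2 * Real.sqrt v + 1 / 2 * -Real.sqrt v = 0 := by ring
    have e2 : 1 / 2 * ((1 + v) * Real.sqrt (a - v)) + 1 / 2 * ((1 + v) * Real.sqrt (a - v))
      = (1 + v) * Real.sqrt (a - v) := by ring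
    rw [e1, e2, mul_pow, hs] at h3
    have h4 : v * (2 * a - 1 + (a - 2) * v - v ^ 2) ≤ 0 := by nlinarith
    have h5 : 0 < 2 * a - 1 + (a - 2) * v - v ^ 2 := by nlinarith
    nlinarith [mul_pos hv0 h5]
  · intro hle
    -- membership in terms of `s = √(a - z₁²)`
    have mem : ∀ x y : ℝ, x ^ 2 ≤ a → y ^ 2 ≤ (1 + x ^ 2) ^ 2 * (a - x ^ 2) →
        ∃ s : ℝ, 0 ≤ s ∧ x ^ 2 + s ^ 2 = a ∧ |y| ≤ (1 + a) * s - s ^ 3 := by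
      intro x y hx hy
      have hs : Real.sqrt (a - x ^ 2) ^ 2 = a - x ^ 2 := Real.sq_sqrt (by linarith)
      have hs0 := Real.sqrt_nonneg (a - x ^ 2)
      refine ⟨Real.sqrt (a - x ^ 2), hs0, by linarith, ?_⟩
      generalize Real.sqrt (a - x ^ 2) = s at *
      have e : (1 + a) * s - s ^ 3 = (1 + x ^ 2) * s := by
        have : a = s ^ 2 + x ^ 2 := by linarith
        rw [this]; ring
      rw [e]
      apply abs_le_of_sq_le_sq _ (by positivity)
      rw [mul_pow, hs]; exact hy
    rintro ⟨x, y⟩ ⟨hx, hy⟩ ⟨x', y'⟩ ⟨hx', hy'⟩ p q hp hq hpq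
    obtain ⟨s, hs0, hs, hys⟩ := mem x y hx hy
    obtain ⟨t, ht0, ht, hyt⟩ := mem x' y' hx' hy'
    simp only [Prod.smul_mk, Prod.mk_add_mk, smul_eq_mul, Set.mem_ofPred_eq]
    have hq' : q = 1 - p := by linarith
    have hm0 : 0 ≤ p * s + q * t := by positivity
    have hcirc : (p * x + q * x') ^ 2 + (p * s + q * t) ^ 2 ≤ a := by
      have : (p * x + q * x') ^ 2 + (p * s + q * t) ^ 2 
          = p * (x ^ 2 + s ^ 2) + q * (x' ^ 2 + t ^ 2)
            - p * q * ((x - x') ^ 2 + (s - t) ^ 2) := by rw [hq']; ring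
      rw [this, hs, ht, ← add_mul, hpq]
      have : 0 ≤ p * q * ((x - x') ^ 2 + (s - t) ^ 2) := by positivity
      linarith
    have hcube : (p * s + q * t) ^ 3 ≤ p * s ^ 3 + q * t ^ 3 := by
      have : p * s ^ 3 + q * t ^ 3 - (p * s + q * t) ^ 3
          = p * q * (s - t) ^ 2 * ((1 + p) * s + (1 + q) * t) := by rw [hq']; ring
      have h0 : 0 ≤ p * q * (s - t) ^ 2 * ((1 + p) * s + (1 + q) * t) := by positivity
      linarith
    have hY : |p * y + q * y'| ≤ (1 + a) * (p * s + q * t) - (p * s + q * t) ^ 3 := by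
      have h1 : |p * y + q * y'| ≤ p * |y| + q * |y'| := by
        refine (abs_add_le _ _).trans ?_
        rw [abs_mul, abs_mul, abs_of_nonneg hp, abs_of_nonneg hq]
      have h3 := mul_le_mul_of_nonneg_left hys hp
      have h4 := mul_le_mul_of_nonneg_left hyt hq
      linarith
    generalize p * s + q * t = m at *
    generalize p * x + q * x' = X at *
    generalize p * y + q * y' = Y at *
    refine ⟨by linarith [sq_nonneg m], ?_⟩
    have hr : Real.sqrt (a - X ^ 2) ^ 2 = a - X ^ 2 := Real.sq_sqrt (by linarith [sq_nonneg m])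
    have hmr : m ≤ Real.sqrt (a - X ^ 2) := Real.le_sqrt_of_sq_le (by linarith)
    generalize Real.sqrt (a - X ^ 2) = r at *
    have hra : r ^ 2 ≤ a := by linarith [sq_nonneg X]
    have hmono : (1 + a) * m - m ^ 3 ≤ (1 + a) * r - r ^ 3 := by
      have h1 : r ^ 2 + r * m + m ^ 2 ≤ 3 * a := by
        have g1 : r * m ≤ r * r := mul_le_mul_of_nonneg_left hmr (hm0.trans hmr)
        have g2 : m * m ≤ r * r := mul_self_le_mul_self hm0 hmr
        linarith [sq r, sq m]
      have h3 : 0 ≤ (r - m) * (1 + a - (r ^ 2 + r * m + m ^ 2)) :=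
        mul_nonneg (by linarith) (by linarith)
      have h4 : (r - m) * (1 + a - (r ^ 2 + r * m + m ^ 2))
          = ((1 + a) * r - r ^ 3) - ((1 + a) * m - m ^ 3) := by ring
      linarith
    have e : (1 + a) * r - r ^ 3 = (1 + X ^ 2) * r := by
      have : a = r ^ 2 + X ^ 2 := by linarith
      rw [this]; ring
    rw [← hr, ← mul_pow, ← e]
    exact sq_le_sq' (by linarith [neg_abs_le Y]) (by linarith [le_abs_self Y])
end

section
/- Let 0 < T ≤ 1/√2. Then the function φ_T : [−T, T] → ℝ, φ_T(u) := (1 + u²)√(T² − u²), is concave on [−T, T]. -/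
/-- key analytic step of Example 4.3. For `0 < T ≤ 1/√2`, the function
`φ_T(u) = (1 + u²) √(T² − u²)` is concave on `[−T, T]`. -/
theorem stmt_14 (T : ℝ) (hT0 : 0 < T) (hT : T ≤ 1 / Real.sqrt 2) :
    ConcaveOn ℝ (Set.Icc (-T) T) (fun u : ℝ => (1 + u ^ 2) * Real.sqrt (T ^ 2 - u ^ 2)) := by
  have hT2 : 2 * T ^ 2 ≤ 1 := by
    have h := pow_le_pow_left₀ hT0.le hT 2
    rw [div_pow, Real.sq_sqrt (by norm_num)] at h
    linarith
  have hpos : ∀ u ∈ interior (Set.Icc (-T) T), 0 < T ^ 2 - u ^ 2 := by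
    intro u hu
    rw [interior_Icc] at hu
    nlinarith [hu.1, hu.2]
  have hs : ∀ u ∈ interior (Set.Icc (-T) T),
      HasDerivAt (fun u : ℝ => Real.sqrt (T ^ 2 - u ^ 2)) (-u / Real.sqrt (T ^ 2 - u ^ 2)) u := by
    intro u hu
    have h := (((hasDerivAt_id u).pow 2).const_sub (T ^ 2)).sqrt (hpos u hu).ne'
    have hp := Real.sqrt_pos.2 (hpos u hu)
    refine h.congr_deriv ?_
    simp
    field_simp
  refine concaveOn_of_hasDerivWithinAt2_nonpos (convex_Icc _ _)
    (f' := fun u => (u * (2 * T ^ 2 - 1) - 3 * u ^ 3) / Real.sqrt (T ^ 2 - u ^ 2))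
    (f'' := fun u => (6 * u ^ 4 - 9 * T ^ 2 * u ^ 2 + 2 * T ^ 4 - T ^ 2)
      / Real.sqrt (T ^ 2 - u ^ 2) ^ 3) (by fun_prop) ?_ ?_ ?_
  · intro u hu
    have hp := Real.sqrt_pos.2 (hpos u hu)
    have hq := Real.sq_sqrt (hpos u hu).le
    have h := (((hasDerivAt_id u).pow 2).const_add 1).mul (hs u hu)
    refine (h.congr_deriv ?_).hasDerivWithinAt
    simp
    field_simp
    rw [hq]
    ring
  · intro u hu
    have hp := Real.sqrt_pos.2 (hpos u hu)
    have hq := Real.sq_sqrt (hpos u hu).le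
    have h := (((hasDerivAt_id u).mul_const (2 * T ^ 2 - 1)).sub
      (((hasDerivAt_id u).pow 3).const_mul 3)).div (hs u hu) hp.ne'
    refine (h.congr_deriv ?_).hasDerivWithinAt
    simp
    field_simp
    rw [hq]
    ring
  · intro u hu
    have hp := hpos u hu
    refine div_nonpos_of_nonpos_of_nonneg ?_ (by positivity)
    nlinarith [mul_nonneg (sq_nonneg u) hp.le, mul_nonneg (sq_nonneg T) (sub_nonneg.2 hT2),
      mul_nonneg (sq_nonneg u) (sq_nonneg T)]
end

section
/- Let T > 0, λ > 0, x₀ ∈ ℝ. Define S := { (y₁, y₂) ∈ ℝ² : y₂ ≥ e^{−T} x₀² + (y₁ − x₀ e^{−T})² / (1 − e^{−T}) } and φ(y₁, y₂) := y₁ + (λ/2) y₁² − (λ/2) y₂. Set y₁^λ := x₀ + (e^T − 1)/λ and y₂^λ := (y₁^λ)² + (e^T − 1)/λ². Then (y₁^λ, y₂^λ) ∈ S, and for every (y₁, y₂) ∈ S one has φ(y₁, y₂) ≤ φ(y₁^λ, y₂^λ) = x₀ + (e^T − 1)/(2λ); i.e., x₀ + (e^T − 1)/(2λ) is the maximum of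 φ over S, attained at (y₁^λ, y₂^λ). -/
/-- equation (MVoptimal): the scalarized mean–variance optimum.
With `S = { (y₁,y₂) : y₂ ≥ e^{−T} x₀² + (y₁ − x₀ e^{−T})² / (1 − e^{−T}) }` and
`φ(y₁,y₂) = y₁ + (λ/2) y₁² − (λ/2) y₂`, the point
`(y₁^λ, y₂^λ) = (x₀ + (e^T−1)/λ, (y₁^λ)² + (e^T−1)/λ²)` lies in `S` and maximizes `φ`
over `S`, with maximal value `x₀ + (e^T − 1)/(2λ)`. -/
theorem stmt_15 (T lam x₀ : ℝ) (hT : 0 < T) (hlam : 0 < lam) :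
    let S : Set (ℝ × ℝ) :=
      {y | Real.exp (-T) * x₀ ^ 2 + (y.1 - x₀ * Real.exp (-T)) ^ 2 / (1 - Real.exp (-T)) ≤ y.2}
    let φ : ℝ × ℝ → ℝ := fun y => y.1 + lam / 2 * y.1 ^ 2 - lam / 2 * y.2
    let y₁ : ℝ := x₀ + (Real.exp T - 1) / lam
    let y₂ : ℝ := y₁ ^ 2 + (Real.exp T - 1) / lam ^ 2
    (y₁, y₂) ∈ S ∧ (∀ y ∈ S, φ y ≤ φ (y₁, y₂)) ∧
      φ (y₁, y₂) = x₀ + (Real.exp T - 1) / (2 * lam) := by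
  intro S φ y₁ y₂
  have hE : 0 < Real.exp T - 1 := by
    have := Real.one_lt_exp_iff.mpr hT
    linarith
  have key : ∀ y : ℝ, Real.exp (-T) * x₀ ^ 2
      + (y - x₀ * Real.exp (-T)) ^ 2 / (1 - Real.exp (-T))
      = y ^ 2 + (y - x₀) ^ 2 / (Real.exp T - 1) := by
    intro y
    rw [Real.exp_neg]
    obtain ⟨k, hk⟩ : ∃ k, k = Real.exp T - 1 := ⟨_, rfl⟩
    have hk' : Real.exp T = k + 1 := by linarith
    rw [← hk] at hE
    rw [hk']
    have h1 : k + 1 ≠ 0 := by positivity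
    have h2 : 1 - (k + 1)⁻¹ = k / (k + 1) := by field_simp; ring
    rw [h2]
    have h3 : k + 1 - 1 = k := by ring
    rw [h3]
    field_simp
    ring
  have hval : φ (y₁, y₂) = x₀ + (Real.exp T - 1) / (2 * lam) := by
    simp only [φ, y₁, y₂]
    field_simp
    ring
  refine ⟨?_, ?_, hval⟩
  · change _ ≤ y₂
    simp only [key, y₂]
    apply le_of_eq
    simp only [y₁]
    field_simp
    ring
  · intro y hy
    rw [hval]
    change _ ≤ y.2 at hy
    rw [key] at hy
    simp only [φ]
    generalize Real.exp T - 1 = k at hE hy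
    have h := mul_le_mul_of_nonneg_left hy (by positivity : 0 ≤ lam / 2)
    have h2 : x₀ + k / (2 * lam) - (y.1 - lam / 2 * ((y.1 - x₀) ^ 2 / k))
        = (k - lam * (y.1 - x₀)) ^ 2 / (2 * lam * k) := by
      field_simp
      ring
    have h3 : 0 ≤ (k - lam * (y.1 - x₀)) ^ 2 / (2 * lam * k) := by positivity
    linarith
end
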